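/- Let n = 2ν be even and J₀ the canonical antisymmetric matrix of order n. Let V : 𝕊₂ₙ → ℝ be a function on the space of real symmetric 2n×2n matrices that is Frechet differentiable at P ∈ 𝕊₂ₙ, with Frobenius gradient Q ∈ 𝕊₂ₙ (i.e., the derivative of V at P in direction δ ∈ 𝕊₂ₙ equals ⟨Q, δ⟩). Suppose V is symplectically invariant: V(S P Sᵀ) = V(P) for every symplectic matrix σ ∈ ℝ^{n×n}, where S := diag(Iₙ, σ). Partition the matrix H := Q P into n×n blocks H = [[H¹¹, H¹²],[H²¹, H²²]]. Then 𝐇(H²²) = 0, i.e., the lower-right block H²² satisfies H²² J₀ + J₀ (H²²)ᵀ = 0 after projection: (H²² + J₀ (H²²)ᵀ J₀)/2 = 0. -/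

import Mathlib

open Matrix
open scoped Kronecker

attribute [local instance] Matrix.frobeniusNormedAddCommGroup Matrix.frobeniusNormedSpace

/-- Index type for matrices of even order `n = 2ν`. -/
abbrev Idx (ν : ℕ) := Fin ν × Fin 2

/-- The canonical antisymmetric matrix `J₀ = I_ν ⊗ [[0,1],[-1,0]]` of order `n = 2ν`. -/
noncomputable def J0 (ν : ℕ) : Matrix (Idx ν) (Idx ν) ℝ :=
  (1 : Matrix (Fin ν) (Fin ν) ℝ) ⊗ₖ !![(0 : ℝ), 1; -1, 0]

/-- A derivative vanishes along the velocity of a quadratic curve on which the function is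
constant. -/
theorem HasFDerivAt.apply_eq_zero_of_const_on_quadratic {E : Type*} [NormedAddCommGroup E]
    [NormedSpace ℝ E] {V : E → ℝ} {L : E →L[ℝ] ℝ} {P : E} (hd : HasFDerivAt V L P) (A B : E)
    (h : ∀ t : ℝ, V (P + t • A + t ^ 2 • B) = V P) : L A = 0 := by
  have hγ : HasDerivAt (fun t : ℝ => P + t • A + t ^ 2 • B) A 0 := by
    have h₁ := ((hasDerivAt_id (0 : ℝ)).smul_const A).const_add P
    have h₂ := (hasDerivAt_pow 2 (0 : ℝ)).smul_const B
    simpa using h₁.fun_add h₂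
  have hd' : HasFDerivAt V L ((fun t : ℝ => P + t • A + t ^ 2 • B) 0) := by simpa using hd
  have hc := hd'.comp_hasDerivAt (0 : ℝ) hγ
  have hconst : V ∘ (fun t : ℝ => P + t • A + t ^ 2 • B) = fun _ => V P := funext h
  rw [hconst] at hc
  exact hc.unique (hasDerivAt_const _ _)

/-- A real matrix whose quadratic form vanishes is antisymmetric. -/
theorem Matrix.transpose_eq_neg_of_dotProduct_mulVec_eq_zero {m : Type*} [Fintype m]
    {M : Matrix m m ℝ} (h : ∀ v : m → ℝ, v ⬝ᵥ (M *ᵥ v) = 0) : Mᵀ = -M := by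
  classical
  ext i j
  have hi := h (Pi.single i 1)
  have hj := h (Pi.single j 1)
  have hij := h (Pi.single i 1 + Pi.single j 1)
  simp only [mulVec_add, dotProduct_add, add_dotProduct, mulVec_single_one,
    single_one_dotProduct, col_apply] at hi hj hij
  simp only [transpose_apply, neg_apply]
  linarith

theorem J0_transpose (ν : ℕ) : (J0 ν)ᵀ = -J0 ν := by
  ext ⟨i, a⟩ ⟨j, b⟩
  fin_cases a <;> fin_cases b <;> simp [J0, kroneckerMap_apply, one_apply, eq_comm]

theorem J0_mul_J0 (ν : ℕ) : J0 ν * J0 ν = -1 := by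
  have h : !![(0 : ℝ), 1; -1, 0] * !![(0 : ℝ), 1; -1, 0] = -1 := by
    ext a b
    fin_cases a <;> fin_cases b <;> simp
  rw [J0, ← mul_kronecker_mul, h, one_mul, ← neg_one_smul ℝ (1 : Matrix (Fin 2) (Fin 2) ℝ),
    kronecker_smul, one_kronecker_one, neg_one_smul]

theorem J0_dotProduct_self (ν : ℕ) (v : Idx ν → ℝ) : v ⬝ᵥ (J0 ν *ᵥ v) = 0 := by
  have h : v ⬝ᵥ (J0 ν *ᵥ v) = -(v ⬝ᵥ (J0 ν *ᵥ v)) := by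
    conv_lhs => rw [dotProduct_mulVec, ← mulVec_transpose, J0_transpose, neg_mulVec,
      neg_dotProduct, dotProduct_comm]
  linarith

/-- Symplectic transvections are symplectic. -/
theorem transvection_mul_J0_mul_transpose (ν : ℕ) (v : Idx ν → ℝ) (t : ℝ) :
    (1 + t • (vecMulVec v v * J0 ν)) * J0 ν * (1 + t • (vecMulVec v v * J0 ν))ᵀ = J0 ν := by
  have h₁ : vecMulVec v v * J0 ν * J0 ν = -vecMulVec v v := by
    rw [Matrix.mul_assoc, J0_mul_J0, mul_neg, mul_one]
  have h₂ : J0 ν * (J0 ν * vecMulVec v v) = -vecMulVec v v := by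
    rw [← Matrix.mul_assoc, J0_mul_J0, neg_mul, one_mul]
  have h₃ : vecMulVec v v * (J0 ν * vecMulVec v v) = 0 := by
    rw [mul_vecMulVec, vecMulVec_mul_vecMulVec, J0_dotProduct_self, zero_smul,
      vecMulVec_zero]
  rw [transpose_add, transpose_one, transpose_smul, transpose_mul, transpose_vecMulVec,
    J0_transpose]
  simp only [add_mul, mul_add, smul_mul_assoc, mul_smul_comm, one_mul, mul_one, neg_mul,
    mul_neg, h₁, h₂, h₃, smul_neg, smul_zero]
  module

theorem stmt_5 (ν : ℕ)
    (V : Matrix (Idx ν ⊕ Idx ν) (Idx ν ⊕ Idx ν) ℝ → ℝ)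
    (P Q : Matrix (Idx ν ⊕ Idx ν) (Idx ν ⊕ Idx ν) ℝ)
    (hP : Pᵀ = P) (hQ : Qᵀ = Q)
    -- V is Frechet differentiable at P with Frobenius gradient Q on symmetric directions
    (L : Matrix (Idx ν ⊕ Idx ν) (Idx ν ⊕ Idx ν) ℝ →L[ℝ] ℝ)
    (hd : HasFDerivAt V L P)
    (hL : ∀ δ, δᵀ = δ → L δ = (Qᵀ * δ).trace)
    -- symplectic invariance of V
    (hinv : ∀ σ : Matrix (Idx ν) (Idx ν) ℝ, σ * J0 ν * σᵀ = J0 ν →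
        V (fromBlocks 1 0 0 σ * P * (fromBlocks 1 0 0 σ)ᵀ) = V P) :
    (1 / 2 : ℝ) •
        (toBlocks₂₂ (Q * P) + J0 ν * (toBlocks₂₂ (Q * P))ᵀ * J0 ν) = 0 := by
  set H := Q * P with hH
  set N := toBlocks₂₂ H with hN
  have hskew : (J0 ν * Nᵀ)ᵀ = -(J0 ν * Nᵀ) := by
    refine transpose_eq_neg_of_dotProduct_mulVec_eq_zero fun v => ?_
    set τ := vecMulVec v v * J0 ν with hτ
    set T : Matrix (Idx ν ⊕ Idx ν) (Idx ν ⊕ Idx ν) ℝ := fromBlocks 0 0 0 τ with hT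
    have hS (t : ℝ) : fromBlocks 1 0 0 (1 + t • τ) = 1 + t • T := by
      rw [hT, ← fromBlocks_one, fromBlocks_smul, fromBlocks_add]
      simp
    have hLA : L (T * P + P * Tᵀ) = 0 := by
      refine hd.apply_eq_zero_of_const_on_quadratic _ (T * P * Tᵀ) fun t => ?_
      rw [← hinv (1 + t • τ) (transvection_mul_J0_mul_transpose ν v t), hS, transpose_add,
        transpose_one, transpose_smul]
      congr 1
      simp only [add_mul, mul_add, smul_mul_assoc, mul_smul_comm, one_mul, mul_one, smul_smul,
        smul_add, pow_two]
      abel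
    rw [hL _ (by simp [hP, add_comm]), hQ, mul_add, trace_add] at hLA
    have h₁ : (Q * (T * P)).trace = (Hᵀ * T).trace := by
      rw [← Matrix.mul_assoc, trace_mul_comm, ← Matrix.mul_assoc, hH, transpose_mul, hP, hQ]
    have h₂ : (Q * (P * Tᵀ)).trace = (Hᵀ * T).trace := by
      rw [← Matrix.mul_assoc, ← trace_transpose, transpose_mul, transpose_transpose,
        trace_mul_comm]
    have h₃ : (Hᵀ * T).trace = (Nᵀ * τ).trace := by
      rw [← fromBlocks_toBlocks H, fromBlocks_transpose, hT, fromBlocks_multiply]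
      simp [hN, trace, Fintype.sum_sum_type]
    have h₄ : (Nᵀ * τ).trace = v ⬝ᵥ ((J0 ν * Nᵀ) *ᵥ v) := by
      rw [hτ, ← Matrix.mul_assoc, trace_mul_comm, ← Matrix.mul_assoc, mul_vecMulVec,
        trace_vecMulVec, dotProduct_comm]
    linarith
  rw [transpose_mul, transpose_transpose, J0_transpose, mul_neg, neg_inj] at hskew
  rw [← hskew, Matrix.mul_assoc, J0_mul_J0, mul_neg, mul_one, add_neg_cancel, smul_zero]
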